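/- arXiv:math/0502123 — 5 statements merged into one kernel-verified Lean document; each statement's English description precedes it below -/
import Mathlib

section
/- Let k be an algebraically closed field, K a field extension of k, and p an odd prime with p ≠ char(k). If G is a subgroup of PGL_2(K) isomorphic to (ℤ/p)^r, then G is conjugate in PGL_2(K) to a subgroup of C_p; in particular r ≤ 1. -/
/-- `PGL_n(K)`: the quotient of `GL_n(K)` by its center. -/
abbrev PGL (n : ℕ) (K : Type*) [Field K] :=
  Matrix.GeneralLinearGroup (Fin n) K ⧸ Subgroup.center (Matrix.GeneralLinearGroup (Fin n) K)

open Matrix Polynomial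

theorem PGL.mk_eq_mk_iff {n : ℕ} {K : Type*} [Field K] {A B : GL (Fin n) K} :
    (QuotientGroup.mk A : PGL n K) = QuotientGroup.mk B ↔
      ∃ u : Kˣ, A * GeneralLinearGroup.scalar (Fin n) u = B := by
  simp [QuotientGroup.eq, GeneralLinearGroup.center_eq_range_scalar, eq_inv_mul_iff_mul_eq]

theorem eq_one_of_sq_eq_one_of_pow_eq_one {M : Type*} [Monoid M] {u : M} {p : ℕ} (hodd : Odd p)
    (h2 : u ^ 2 = 1) (hp : u ^ p = 1) : u = 1 := by
  obtain ⟨m, rfl⟩ := hodd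
  simpa [pow_succ, pow_mul, h2] using hp

theorem commute_scalar {n K : Type*} [Fintype n] [DecidableEq n] [Field K] (u : Kˣ)
    (A : GL n K) :
    Commute A (GeneralLinearGroup.scalar n u) := by
  have : GeneralLinearGroup.scalar n u ∈ Subgroup.center (GL n K) := by
    rw [GeneralLinearGroup.center_eq_range_scalar]; exact ⟨u, rfl⟩
  exact Subgroup.mem_center_iff.1 this A

theorem det_scalar_two {K : Type*} [Field K] (u : Kˣ) :
    GeneralLinearGroup.det (GeneralLinearGroup.scalar (Fin 2) u) = u ^ 2 := by
  ext
  simp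

/-- An element of odd order dividing `p` in `PGL_2(K)` lifts to a matrix of determinant one
and of order dividing `p`. -/
theorem PGL.exists_lift_pow_eq_one {K : Type*} [Field K] {p : ℕ} (hodd : Odd p) (g : PGL 2 K)
    (hg : g ^ p = 1) :
    ∃ A : GL (Fin 2) K, (QuotientGroup.mk A : PGL 2 K) = g ∧ A ^ p = 1 ∧
      GeneralLinearGroup.det A = 1 := by
  obtain ⟨A, rfl⟩ := QuotientGroup.mk_surjective g
  obtain ⟨c, hc⟩ := PGL.mk_eq_mk_iff.1 (show QuotientGroup.mk 1 = QuotientGroup.mk (A ^ p) from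
    hg.symm)
  rw [one_mul] at hc
  have hdet := congrArg GeneralLinearGroup.det hc
  rw [det_scalar_two, map_pow] at hdet
  set d := GeneralLinearGroup.det A with hd
  obtain ⟨m, rfl⟩ := hodd
  have hs : (c / d ^ m) ^ 2 = d := by
    rw [div_pow, hdet, div_eq_iff_eq_mul, ← pow_mul, ← pow_succ', mul_comm m 2]
  set s := c / d ^ m with hsdef
  refine ⟨A * GeneralLinearGroup.scalar (Fin 2) s⁻¹, ?_, ?_, ?_⟩
  · exact (PGL.mk_eq_mk_iff.2 ⟨s⁻¹, rfl⟩).symm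
  · rw [(commute_scalar _ A).mul_pow, ← hc, ← map_pow, ← map_mul]
    have : c * s⁻¹ ^ (2 * m + 1) = 1 := by
      rw [inv_pow, mul_inv_eq_one, pow_succ, pow_mul, hs, hsdef, mul_div_cancel]
    rw [this, map_one]
  · rw [map_mul, det_scalar_two, inv_pow, hs, ← hd, mul_inv_cancel]

/-- Matrices of odd order whose classes in `PGL_2(K)` commute already commute. -/
theorem commute_of_commute_mk {K : Type*} [Field K] {p : ℕ} (hodd : Odd p) {A B : GL (Fin 2) K}
    (hA : A ^ p = 1)
    (h : Commute (QuotientGroup.mk A : PGL 2 K) (QuotientGroup.mk B)) : Commute A B := by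
  obtain ⟨u, hu⟩ := PGL.mk_eq_mk_iff.1
    (show (QuotientGroup.mk (A * B) : PGL 2 K) = QuotientGroup.mk (B * A) from h)
  have h2 : u ^ 2 = 1 := by
    have := congrArg GeneralLinearGroup.det hu
    rw [map_mul, map_mul, map_mul, det_scalar_two, mul_comm (GeneralLinearGroup.det B)] at this
    exact mul_eq_left.1 this
  have hconj : A * GeneralLinearGroup.scalar (Fin 2) u = B * A * B⁻¹ := by
    rw [← hu, mul_assoc A B, (commute_scalar u B).eq]
    group
  have hup : u ^ p = 1 := by
    have := congrArg (· ^ p) hconj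
    simp only [conj_pow, (commute_scalar u A).mul_pow, hA, ← map_pow] at this
    have := congrArg (fun M : GL (Fin 2) K => (M : Matrix (Fin 2) (Fin 2) K) 0 0) this
    ext
    simpa [diagonal_pow] using this
  rw [eq_one_of_sq_eq_one_of_pow_eq_one hodd h2 hup, map_one, mul_one] at hu
  exact hu

theorem exists_isRoot_mem_spectrum {K : Type*} [Field K] {n : Type*} [Fintype n] [DecidableEq n]
    [Nonempty n] {f : K[X]} (hf : f.Splits) (hmonic : f.Monic) {A : Matrix n n K}
    (hA : aeval A f = 0) : ∃ ζ : K, f.IsRoot ζ ∧ (A - scalar n ζ).det = 0 := by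
  have : ¬ IsUnit (aeval A (f.roots.map (fun x : K => X - C x)).prod) := by
    have h := hf.eq_prod_roots
    rw [hmonic.leadingCoeff, C_1, one_mul] at h
    rw [← h, hA]
    exact not_isUnit_zero
  obtain ⟨ζ, h1, h2⟩ := spectrum.exists_mem_of_not_isUnit_aeval_prod this
  refine ⟨ζ, h2, ?_⟩
  rw [spectrum.mem_iff, isUnit_iff_isUnit_det, isUnit_iff_ne_zero, not_not] at h1
  rw [← neg_sub, det_neg]
  exact mul_eq_zero_of_right _ h1

theorem det_sub_scalar_two {K : Type*} [Field K] (A : Matrix (Fin 2) (Fin 2) K) (x : K) :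
    (A - scalar (Fin 2) x).det = x ^ 2 - A.trace * x + A.det := by
  simp [det_fin_two, trace_fin_two]
  ring

/-- A unipotent `2 × 2` matrix of order prime to the characteristic is trivial. -/
theorem eq_one_of_trace_eq_two {K : Type*} [Field K] {p : ℕ} (hp : (p : K) ≠ 0)
    {A : Matrix (Fin 2) (Fin 2) K} (hA : A ^ p = 1) (hdet : A.det = 1) (htr : A.trace = 2) :
    A = 1 := by
  have hN : A * (A - 1) = A - 1 := by
    rw [det_fin_two] at hdet
    rw [trace_fin_two] at htr
    have h0 : A 0 0 = 2 - A 1 1 := by linear_combination htr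
    rw [h0] at hdet
    ext i j
    fin_cases i <;> fin_cases j <;> simp [mul_apply, Fin.sum_univ_two, h0] <;>
      first | ring1 | linear_combination -hdet
  have key : ∀ n : ℕ, A ^ n = 1 + (n : K) • (A - 1) := by
    intro n
    induction n with
    | zero => simp
    | succ n ih =>
      rw [pow_succ', ih, mul_add, mul_smul_comm, hN, mul_one]
      push_cast
      module
  have := key p
  rw [hA, left_eq_add, smul_eq_zero, sub_eq_zero] at this
  exact this.resolve_left hp

/-- A nontrivial determinant one matrix of odd order prime to the characteristic is
diagonalizable, with distinct eigenvalues, once the relevant roots of unity are in the field. -/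
theorem exists_conj_diagonal {K : Type*} [Field K] {p : ℕ} (hodd : Odd p) (hpK : (p : K) ≠ 0)
    (hsplit : (X ^ p - 1 : K[X]).Splits) {A : GL (Fin 2) K} (hA : A ^ p = 1)
    (hdet : GeneralLinearGroup.det A = 1) (hne : A ≠ 1) :
    ∃ (P : GL (Fin 2) K) (x y : K), x ≠ y ∧
      ((P * A * P⁻¹ : GL (Fin 2) K) : Matrix (Fin 2) (Fin 2) K) = diagonal ![x, y] := by
  have hA' : (A : Matrix (Fin 2) (Fin 2) K) ^ p = 1 := by
    rw [← Units.val_pow_eq_pow_val, hA, Units.val_one]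
  have hdet' : (A : Matrix (Fin 2) (Fin 2) K).det = 1 := congrArg Units.val hdet
  obtain ⟨x, hx, hxA⟩ := exists_isRoot_mem_spectrum (A := (A : Matrix (Fin 2) (Fin 2) K)) hsplit
    (monic_X_pow_sub_C 1 hodd.pos.ne') (by simp [hA'])
  have hxp : x ^ p = 1 := by simpa [sub_eq_zero] using hx
  have hx0 : x ≠ 0 := by
    rintro rfl
    simp [hodd.pos.ne'] at hxp
  rw [det_sub_scalar_two, hdet'] at hxA
  have hxy : x ≠ x⁻¹ := by
    intro h
    have h2 : x ^ 2 = 1 := by rw [sq]; nth_rewrite 2 [h]; exact mul_inv_cancel₀ hx0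
    have h1 := eq_one_of_sq_eq_one_of_pow_eq_one hodd h2 hxp
    subst h1
    exact hne (Units.ext (eq_one_of_trace_eq_two hpK hA' hdet' (by linear_combination -hxA)))
  have hyA : ((A : Matrix (Fin 2) (Fin 2) K) - scalar (Fin 2) x⁻¹).det = 0 := by
    rw [det_sub_scalar_two, hdet']
    field_simp
    linear_combination hxA
  rw [← hdet', ← det_sub_scalar_two] at hxA
  obtain ⟨v, hv0, hv⟩ := exists_mulVec_eq_zero_iff.2 hxA
  obtain ⟨w, hw0, hw⟩ := exists_mulVec_eq_zero_iff.2 hyA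
  generalize x⁻¹ = y at hxy hw
  have hv' : (A : Matrix (Fin 2) (Fin 2) K) *ᵥ v = x • v := by
    rwa [sub_mulVec, sub_eq_zero, scalar_apply, ← smul_one_eq_diagonal, smul_mulVec, one_mulVec] at hv
  have hw' : (A : Matrix (Fin 2) (Fin 2) K) *ᵥ w = y • w := by
    rwa [sub_mulVec, sub_eq_zero, scalar_apply, ← smul_one_eq_diagonal, smul_mulVec, one_mulVec] at hw
  have hQ : (!![v 0, w 0; v 1, w 1]).det ≠ 0 := by
    intro h0
    obtain ⟨u, hu0, hu⟩ := exists_mulVec_eq_zero_iff.2 h0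
    have e : u 0 • v + u 1 • w = 0 := by
      ext i
      have := congrFun hu i
      fin_cases i <;> simp [mulVec, dotProduct, Fin.sum_univ_two] at this ⊢ <;>
        linear_combination this
    have e' := congrArg ((A : Matrix (Fin 2) (Fin 2) K) *ᵥ ·) e
    simp only [mulVec_add, mulVec_smul, hv', hw', mulVec_zero] at e'
    have e1 : (u 0 * (x - y)) • v = 0 := by
      linear_combination (norm := (simp only [smul_add, smul_zero]; module)) e' - y • e
    have e2 : (u 1 * (y - x)) • w = 0 := by
      linear_combination (norm := (simp only [smul_add, smul_zero]; module)) e' - x • e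
    have a0 : u 0 = 0 := by simpa [hv0, sub_eq_zero, hxy] using e1
    have a1 : u 1 = 0 := by simpa [hw0, sub_eq_zero, hxy.symm] using e2
    exact hu0 (by ext i; fin_cases i <;> simp [a0, a1])
  let Q := GeneralLinearGroup.mkOfDetNeZero _ hQ
  have hAQ : (A : Matrix (Fin 2) (Fin 2) K) * (Q : Matrix (Fin 2) (Fin 2) K) =
      (Q : Matrix (Fin 2) (Fin 2) K) * diagonal ![x, y] := by
    have v0 := congrFun hv' 0
    have v1 := congrFun hv' 1
    have w0 := congrFun hw' 0
    have w1 := congrFun hw' 1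
    simp [mulVec, dotProduct, Fin.sum_univ_two] at v0 v1 w0 w1
    ext i j
    fin_cases i <;> fin_cases j <;>
      simp [Q, GeneralLinearGroup.mkOfDetNeZero, mul_apply, Fin.sum_univ_two, v0, v1, w0, w1] <;>
      ring
  refine ⟨Q⁻¹, x, y, hxy, ?_⟩
  rw [inv_inv, Units.val_mul, Units.val_mul, mul_assoc, hAQ, ← mul_assoc, ← Units.val_mul,
    inv_mul_cancel, Units.val_one, one_mul]

/-- A matrix of order dividing `p` commuting with a diagonal matrix with distinct entries is,
modulo scalars, of the form `diag(ζ, 1)` with `ζ ^ p = 1`. -/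
theorem exists_mk_eq_mk_diagonal {K : Type*} [Field K] {p : ℕ} (hp0 : p ≠ 0)
    {D B : GL (Fin 2) K} {x y : K} (hxy : x ≠ y) (hD : (D : Matrix (Fin 2) (Fin 2) K) = diagonal ![x, y]) (hB : B ^ p = 1)
    (hcomm : Commute D B) :
    ∃ ζ : K, ζ ^ p = 1 ∧ ∃ M : GL (Fin 2) K,
      (M : Matrix (Fin 2) (Fin 2) K) = diagonal ![ζ, 1] ∧
      (QuotientGroup.mk B : PGL 2 K) = QuotientGroup.mk M := by
  have hc : (D : Matrix (Fin 2) (Fin 2) K) * (B : Matrix (Fin 2) (Fin 2) K) = B * D :=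
    congrArg Units.val hcomm.eq
  rw [hD] at hc
  have h01 : (B : Matrix (Fin 2) (Fin 2) K) 0 1 = 0 := by
    have := congrFun (congrFun hc 0) 1
    simp at this
    exact (mul_eq_zero.1 (by linear_combination this :
      (x - y) * (B : Matrix (Fin 2) (Fin 2) K) 0 1 = 0)).resolve_left (sub_ne_zero.2 hxy)
  have h10 : (B : Matrix (Fin 2) (Fin 2) K) 1 0 = 0 := by
    have := congrFun (congrFun hc 1) 0
    simp at this
    exact (mul_eq_zero.1 (by linear_combination -this :
      (x - y) * (B : Matrix (Fin 2) (Fin 2) K) 1 0 = 0)).resolve_left (sub_ne_zero.2 hxy)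
  set a := (B : Matrix (Fin 2) (Fin 2) K) 0 0
  set b := (B : Matrix (Fin 2) (Fin 2) K) 1 1
  have hBd : (B : Matrix (Fin 2) (Fin 2) K) = diagonal ![a, b] := by
    ext i j
    fin_cases i <;> fin_cases j <;> simp [a, b, h01, h10]
  have hpow : diagonal (![a, b] ^ p) = (1 : Matrix (Fin 2) (Fin 2) K) := by
    rw [← diagonal_pow, ← hBd, ← Units.val_pow_eq_pow_val, hB, Units.val_one]
  have ha : a ^ p = 1 := by simpa using congrFun (congrFun hpow 0) 0
  have hb : b ^ p = 1 := by simpa using congrFun (congrFun hpow 1) 1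
  have hb0 : b ≠ 0 := by rintro h; simp [h, hp0] at hb
  have ha0 : a ≠ 0 := by rintro h; simp [h, hp0] at ha
  refine ⟨a / b, by rw [div_pow, ha, hb, div_one], GeneralLinearGroup.mkOfDetNeZero
    (diagonal ![a / b, 1]) (by simp [ha0, hb0]), rfl, PGL.mk_eq_mk_iff.2
      ⟨Units.mk0 b⁻¹ (inv_ne_zero hb0), ?_⟩⟩
  ext i j
  fin_cases i <;> fin_cases j <;>
    simp [hBd, GeneralLinearGroup.mkOfDetNeZero, div_eq_mul_inv, hb0]

/-- for `p` an odd prime `≠ char k`, any subgroup of `PGL_2(K)` isomorphic to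
`(ℤ/p)^r` is conjugate to a subgroup of `C_p` (classes of `diag(ζ,1)` with `ζ^p = 1`);
in particular `r ≤ 1`. -/
theorem p_elementary_PGL2_conjugate_into_Cp
    (k : Type*) [Field k] [IsAlgClosed k]
    (K : Type*) [Field K] [Algebra k K]
    (p : ℕ) (hp : p.Prime) (hodd : Odd p) (hchar : ringChar k ≠ p)
    (r : ℕ) (G : Subgroup (PGL 2 K))
    (hG : Nonempty (G ≃* Multiplicative (Fin r → ZMod p))) :
    (∃ φ : PGL 2 K,
      ∀ g ∈ Subgroup.map (MulAut.conj φ).toMonoidHom G,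
        ∃ ζ : K, ζ ^ p = 1 ∧
          ∃ M : Matrix.GeneralLinearGroup (Fin 2) K,
            (M : Matrix (Fin 2) (Fin 2) K) = Matrix.diagonal ![ζ, 1] ∧
            g = QuotientGroup.mk M) ∧
    r ≤ 1 := by
  have := Fact.mk hp
  obtain ⟨e⟩ := hG
  have hGp : ∀ g ∈ G, g ^ p = 1 := by
    intro g hg
    have : (⟨g, hg⟩ : G) ^ p = 1 := e.injective (by
      rw [map_pow, map_one]
      apply Multiplicative.toAdd.injective
      ext i
      simp)
    simpa using congrArg Subtype.val this
  have hGc : ∀ g ∈ G, ∀ h ∈ G, Commute g h := by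
    intro g hg h hh
    have : (⟨g, hg⟩ : G) * ⟨h, hh⟩ = ⟨h, hh⟩ * ⟨g, hg⟩ := e.injective (by
      rw [map_mul, map_mul, mul_comm])
    exact congrArg Subtype.val this
  have hpK : (p : K) ≠ 0 := by
    intro h
    rw [← map_natCast (algebraMap k K), map_eq_zero, ringChar.spec] at h
    exact (hp.eq_one_or_self_of_dvd _ h).elim (fun h => CharP.ringChar_ne_one h) hchar
  have hsplit : (X ^ p - 1 : K[X]).Splits := by
    have h := (IsAlgClosed.splits (X ^ p - 1 : k[X])).map (algebraMap k K)
    rwa [Polynomial.map_sub, Polynomial.map_pow, map_X, Polynomial.map_one] at h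
  have hconj : ∃ φ : PGL 2 K,
      ∀ g ∈ Subgroup.map (MulAut.conj φ).toMonoidHom G,
        ∃ ζ : K, ζ ^ p = 1 ∧
          ∃ M : Matrix.GeneralLinearGroup (Fin 2) K,
            (M : Matrix (Fin 2) (Fin 2) K) = Matrix.diagonal ![ζ, 1] ∧
            g = QuotientGroup.mk M := by
    by_cases hbot : G = ⊥
    · subst hbot
      refine ⟨1, fun g hg => ⟨1, one_pow p, 1, ?_, ?_⟩⟩
      · ext i j
        fin_cases i <;> fin_cases j <;> simp
      · simpa using hg
    obtain ⟨g, hg, hg1⟩ := G.bot_or_exists_ne_one.resolve_left hbot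
    obtain ⟨A, rfl, hA, hdet⟩ := PGL.exists_lift_pow_eq_one hodd g (hGp g hg)
    obtain ⟨P, x, y, hxy, hD⟩ := exists_conj_diagonal hodd hpK hsplit hA hdet (by
      rintro rfl
      exact hg1 rfl)
    refine ⟨QuotientGroup.mk P, ?_⟩
    rintro _ ⟨h, hh, rfl⟩
    obtain ⟨B, rfl, hB, -⟩ := PGL.exists_lift_pow_eq_one hodd h (hGp h hh)
    have hAB := commute_of_commute_mk hodd hA (hGc _ hg _ hh)
    exact exists_mk_eq_mk_diagonal (B := P * B * P⁻¹) hp.ne_zero hxy hD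
      (by rw [conj_pow, hB, mul_one, mul_inv_cancel]) (Commute.conj_iff P |>.2 hAB)
  refine ⟨hconj, ?_⟩
  obtain ⟨φ, hφ⟩ := hconj
  have hφ' (g : G) := hφ _ (Subgroup.mem_map_of_mem (MulAut.conj φ).toMonoidHom g.2)
  choose f hf M hM hgM using hφ'
  have hinj : Function.Injective
      (fun g : G => (⟨f g, (mem_nthRootsFinset hp.pos 1).2 (hf g)⟩ : nthRootsFinset p (1 : K))) := by
    intro g h hgh
    have hfgh : f g = f h := congrArg Subtype.val hgh
    have : M g = M h := Units.ext (by rw [hM, hM, hfgh])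
    exact Subtype.ext ((MulAut.conj φ).injective ((hgM g).trans (this ▸ (hgM h).symm)))
  have hcard := Nat.card_le_card_of_injective _ hinj
  have hle : (nthRootsFinset p (1 : K)).card ≤ p := by
    classical
    exact (Multiset.toFinset_card_le _).trans (card_nthRoots p 1)
  have hGcard : Nat.card G = p ^ r := by
    rw [Nat.card_congr e.toEquiv]
    simp
  rw [hGcard, Nat.card_eq_fintype_card, Fintype.card_coe] at hcard
  exact (Nat.pow_le_pow_iff_right hp.one_lt).1 ((hcard.trans hle).trans_eq (pow_one p).symm)
end

section
/- Let k be an algebraically closed field and p an odd prime with p ≠ char(k). Let G be a subgroup of Aut_k(k(x,y)) such that every element of G maps the subfield k(x) onto itself. If G is isomorphic to (ℤ/p)^r, then r ≤ 2. -/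
/-- The field `k(x,y)` of rational functions in two variables over `k`. -/
noncomputable abbrev Kxy (k : Type*) [Field k] : Type _ :=
  FractionRing (MvPolynomial (Fin 2) k)

/-- The images of the variables `x = X 0` and `y = X 1` in `k(x,y)`. -/
noncomputable abbrev Xv (k : Type*) [Field k] (i : Fin 2) : Kxy k :=
  algebraMap (MvPolynomial (Fin 2) k) (Kxy k) (MvPolynomial.X i)

/-- The subfield `k(x) ⊆ k(x,y)`. -/
noncomputable abbrev Kx (k : Type*) [Field k] : IntermediateField k (Kxy k) :=
  IntermediateField.adjoin k {Xv k 0}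

open Polynomial IntermediateField

theorem iSup_eigenspace_eq_ker_aeval_prod {F V : Type*} [Field F] [AddCommGroup V] [Module F V]
    (T : Module.End F V) (s : Finset F) :
    ⨆ a ∈ s, T.eigenspace a = LinearMap.ker (aeval T (∏ a ∈ s, (X - C a))) := by
  classical
  induction s using Finset.induction_on with
  | empty => simp [Module.End.one_eq_id]
  | insert a s ha ih =>
    rw [Finset.iSup_insert, ih, Finset.prod_insert ha,
      ← sup_ker_aeval_eq_ker_aeval_mul_of_coprime]
    · congr 1
      ext v
      simp [sub_eq_zero]
    · exact IsCoprime.prod_right fun b hb ↦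
        isCoprime_X_sub_C_of_isUnit_sub (sub_ne_zero.2 (ne_of_mem_of_not_mem hb ha).symm).isUnit

/-- An endomorphism of order dividing `n` is diagonalizable when `F` contains a primitive `n`-th
root of unity. -/
theorem iSup_eigenspace_eq_top_of_pow_eq_one {F V : Type*} [Field F] [AddCommGroup V] [Module F V]
    {n : ℕ} (hn : 0 < n) {ζ : F} (hζ : IsPrimitiveRoot ζ n) {T : Module.End F V}
    (hT : T ^ n = 1) : ⨆ a, T.eigenspace a = ⊤ := by
  refine top_le_iff.1 (le_trans ?_ (iSup₂_le_iSup (· ∈ nthRootsFinset n (1 : F)) _))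
  rw [iSup_eigenspace_eq_ker_aeval_prod, ← X_pow_sub_one_eq_prod hn hζ]
  simp [hT]

/-- A non-scalar endomorphism of finite order has eigenvectors for two distinct eigenvalues. -/
theorem exists_eigenvectors_of_pow_eq_one {F V : Type*} [Field F] [AddCommGroup V] [Module F V]
    {n : ℕ} (hn : 0 < n) {ζ : F} (hζ : IsPrimitiveRoot ζ n) {T : Module.End F V}
    (hT : T ^ n = 1) (hns : ∀ a : F, T ≠ a • 1) :
    ∃ a b : F, a ≠ b ∧ ∃ u v : V, u ≠ 0 ∧ v ≠ 0 ∧ T u = a • u ∧ T v = b • v := by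
  have htop := iSup_eigenspace_eq_top_of_pow_eq_one hn hζ hT
  have key : ∀ a, ∃ b, b ≠ a ∧ T.eigenspace b ≠ ⊥ := by
    intro a
    by_contra! h
    have : T.eigenspace a = ⊤ := by
      refine top_le_iff.1 (htop ▸ iSup_le fun b ↦ ?_)
      by_cases hb : b = a
      · rw [hb]
      · simp [h b hb]
    refine hns a (LinearMap.ext fun v ↦ ?_)
    have hv : v ∈ T.eigenspace a := this ▸ Submodule.mem_top
    simpa using Module.End.mem_eigenspace_iff.1 hv
  obtain ⟨b, -, hb⟩ := key 0
  obtain ⟨a, hab, ha⟩ := key b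
  obtain ⟨u, hu, hu0⟩ := Submodule.exists_mem_ne_zero_of_ne_bot ha
  obtain ⟨v, hv, hv0⟩ := Submodule.exists_mem_ne_zero_of_ne_bot hb
  exact ⟨a, b, hab, u, v, hu0, hv0, Module.End.mem_eigenspace_iff.1 hu,
    Module.End.mem_eigenspace_iff.1 hv⟩

section Moebius

variable {F L : Type*} [Field F] [Field L] [Algebra F L]

theorem Transcendental.coeff_eq_zero_of_quadratic {y : L} (hy : Transcendental F y) {a b c : F}
    (h : algebraMap F L a + algebraMap F L b * y + algebraMap F L c * y ^ 2 = 0) :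
    a = 0 ∧ b = 0 ∧ c = 0 := by
  have h0 : C a + C b * X + C c * X ^ 2 = 0 := by
    by_contra hne
    exact hy ⟨_, hne, by simpa using h⟩
  refine ⟨?_, ?_, ?_⟩
  · simpa [coeff_X, coeff_X_pow] using congrArg (coeff · 0) h0
  · simpa [coeff_X, coeff_X_pow, coeff_C] using congrArg (coeff · 1) h0
  · simpa [coeff_X, coeff_X_pow, coeff_C] using congrArg (coeff · 2) h0

theorem adjoin_simple_algEquiv_eq_top {L' : Type*} [Field L'] [Algebra F L'] (e : L ≃ₐ[F] L')
    {u : L} (hu : F⟮u⟯ = ⊤) : F⟮e u⟯ = ⊤ := by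
  have h := adjoin_map F {u} (e : L →ₐ[F] L')
  rw [hu, ← AlgHom.fieldRange_eq_map] at h
  simp only [Set.image_singleton] at h
  exact h.symm.trans (AlgHom.fieldRange_eq_top.2 e.surjective)

theorem algEquiv_eq_of_apply_generator_eq {y : L} (hytop : F⟮y⟯ = ⊤) {σ τ : L ≃ₐ[F] L}
    (h : σ y = τ y) : σ = τ := by
  have hle : F⟮y⟯ ≤ (AlgHom.equalizer (σ : L →ₐ[F] L) (τ : L →ₐ[F] L)).toIntermediateField
      (fun x hx ↦ by
        have hx' : σ x = τ x := hx
        change σ x⁻¹ = τ x⁻¹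
        rw [map_inv₀, map_inv₀, hx']) :=
    adjoin_simple_le_iff.2 h
  ext x
  exact hle (hytop ▸ mem_top : x ∈ F⟮y⟯)

theorem transcendental_algEquiv_apply {y : L} (hy : Transcendental F y) (σ : L ≃ₐ[F] L) :
    Transcendental F (σ y) := fun h ↦
  hy ((isAlgebraic_algHom_iff (σ : L →ₐ[F] L) σ.injective).1 h)

/-- Two generators of a purely transcendental extension of transcendence degree one differ by a
fractional linear transformation. -/
theorem exists_moebius {y u : L} (hy : Transcendental F y) (hytop : F⟮y⟯ = ⊤)
    (hu : Transcendental F u) (hutop : F⟮u⟯ = ⊤) :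
    ∃ a b c d : F, a * d - b * c ≠ 0 ∧
      algebraMap F L c * y + algebraMap F L d ≠ 0 ∧
      u * (algebraMap F L c * y + algebraMap F L d) = algebraMap F L a * y + algebraMap F L b := by
  let e : RatFunc F ≃ₐ[F] L := (RatFunc.algEquivOfTranscendental y hy).trans
    ((equivOfEq hytop).trans topEquiv)
  have he : ∀ f, e f = aeval y f.num / aeval y f.denom := fun f ↦
    RatFunc.algEquivOfTranscendental_apply y hy f
  obtain ⟨f, hef⟩ := e.surjective u
  have hdeg := RatFunc.finrank_eq_max_natDegree f
  rw [e.eq_symm_apply.2 hef, adjoin_simple_algEquiv_eq_top e.symm hutop,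
    IntermediateField.finrank_top, ← e.eq_symm_apply.2 hef] at hdeg
  obtain ⟨a, b, hab⟩ := exists_eq_X_add_C_of_natDegree_le_one (p := f.num) (by omega)
  obtain ⟨c, d, hcd⟩ := exists_eq_X_add_C_of_natDegree_le_one (p := f.denom) (by omega)
  have hne : aeval y f.denom ≠ 0 := fun h ↦ hy ⟨_, f.denom_ne_zero, h⟩
  have hu' := he f
  rw [hef, eq_div_iff hne, hab, hcd] at hu'
  rw [hcd] at hne
  simp only [map_add, map_mul, aeval_C, aeval_X] at hu' hne
  refine ⟨a, b, c, d, fun hdet ↦ hu ?_, hne, hu'⟩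
  have hdet' : algebraMap F L a * algebraMap F L d - algebraMap F L b * algebraMap F L c = 0 := by
    simpa using congrArg (algebraMap F L) hdet
  have hc : algebraMap F L c * u = algebraMap F L a := mul_right_cancel₀ hne <| by
    linear_combination algebraMap F L c * hu' - hdet'
  have hd : algebraMap F L d * u = algebraMap F L b := mul_right_cancel₀ hne <| by
    linear_combination algebraMap F L d * hu' + y * hdet'
  by_cases hc0 : c = 0
  · have hd0 : d ≠ 0 := fun h ↦ hne (by simp [hc0, h])
    have : u = algebraMap F L (b / d) := by
      rw [map_div₀, ← hd, mul_div_cancel_left₀ _ (by simpa using hd0)]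
    exact this ▸ isAlgebraic_algebraMap _
  · have : u = algebraMap F L (a / c) := by
      rw [map_div₀, ← hc, mul_div_cancel_left₀ _ (by simpa using hc0)]
    exact this ▸ isAlgebraic_algebraMap _

/-- An automorphism of odd order acts on a suitable generator by multiplication by a scalar. -/
theorem exists_generator_apply_eq_smul {y : L} (hy : Transcendental F y) (hytop : F⟮y⟯ = ⊤)
    {n : ℕ} (hn : Odd n) {ζ : F} (hζ : IsPrimitiveRoot ζ n) {σ : L ≃ₐ[F] L} (hσ : σ ^ n = 1)
    (hσ1 : σ ≠ 1) :
    ∃ (z : L) (a : F), Transcendental F z ∧ F⟮z⟯ = ⊤ ∧ a ≠ 1 ∧ σ z = algebraMap F L a * z := by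
  obtain ⟨a, b, c, d, hdet, hw, hσy⟩ := exists_moebius hy hytop
    (transcendental_algEquiv_apply hy σ) (adjoin_simple_algEquiv_eq_top σ hytop)
  set w := algebraMap F L c * y + algebraMap F L d with hwdef
  let M : Matrix (Fin 2) (Fin 2) F := !![d, b; c, a]
  let ι : (Fin 2 → F) → L := fun v ↦ algebraMap F L (v 0) + algebraMap F L (v 1) * y
  have hι0 : ∀ v, ι v = 0 → v = 0 := fun v hv ↦ by
    obtain ⟨h0, h1, -⟩ := hy.coeff_eq_zero_of_quadratic (a := v 0) (b := v 1) (c := 0)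
      (by simpa using hv)
    ext i; fin_cases i <;> simp [h0, h1]
  have hM : ∀ v, ι (M.mulVec v) = w * σ (ι v) := fun v ↦ by
    simp only [ι, M, Matrix.mulVec, dotProduct, Fin.sum_univ_two, map_add, map_mul,
      AlgEquiv.commutes, Matrix.of_apply, Matrix.cons_val', Matrix.cons_val_zero, Matrix.cons_val_one,
      Matrix.cons_val_fin_one]
    linear_combination -algebraMap F L (v 1) * hσy - algebraMap F L (v 0) * hwdef
  have hMpow : ∀ m : ℕ, ∃ W : L, ∀ v, ι ((M ^ m).mulVec v) = W * (σ ^ m) (ι v) := by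
    intro m
    induction m with
    | zero => exact ⟨1, by simp⟩
    | succ m ih =>
      obtain ⟨W, hW⟩ := ih
      refine ⟨w * σ W, fun v ↦ ?_⟩
      rw [pow_succ', ← Matrix.mulVec_mulVec, hM, hW, map_mul, pow_succ', AlgEquiv.mul_apply,
        mul_assoc]
  obtain ⟨P, hP⟩ : ∃ P : F, M ^ n = P • 1 := by
    obtain ⟨W, hW⟩ := hMpow n
    have h0 := hW ![1, 0]
    have h1 := hW ![0, 1]
    simp only [ι, hσ, Matrix.mulVec, dotProduct, Fin.sum_univ_two, AlgEquiv.one_apply,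
      Matrix.cons_val_zero, Matrix.cons_val_one, mul_one, mul_zero, add_zero, zero_add, map_one,
      map_zero, one_mul, zero_mul] at h0 h1
    obtain ⟨e0, e1, e2⟩ := hy.coeff_eq_zero_of_quadratic (a := (M ^ n) 0 1)
      (b := (M ^ n) 1 1 - (M ^ n) 0 0) (c := -(M ^ n) 1 0) (by
        simp only [map_sub, map_neg]
        linear_combination h1 - y * h0)
    refine ⟨(M ^ n) 0 0, ?_⟩
    ext i j
    fin_cases i <;> fin_cases j <;> simp [e0, neg_eq_zero.1 e2, sub_eq_zero.1 e1]
  have hMdet : M.det ≠ 0 := by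
    simp only [M, Matrix.det_fin_two_of]
    exact fun h ↦ hdet (by linear_combination h)
  have hPdet : P ^ 2 = M.det ^ n := by
    rw [← Matrix.det_pow, hP, Matrix.det_smul]; simp
  have hP0 : P ≠ 0 := fun h ↦ pow_ne_zero n hMdet (by rw [← hPdet, h]; simp)
  obtain ⟨e, he0, he⟩ : ∃ e : F, e ≠ 0 ∧ e ^ n = P := by
    obtain ⟨m, rfl⟩ := hn
    refine ⟨P / M.det ^ m, div_ne_zero hP0 (pow_ne_zero _ hMdet), ?_⟩
    rw [div_pow, ← pow_mul, mul_comm m, pow_mul, ← hPdet, pow_succ, ← pow_mul,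
      mul_div_cancel_left₀ _ (pow_ne_zero _ hP0)]
  have hT : (Matrix.toLin' (e⁻¹ • M)) ^ n = 1 := by
    rw [← Matrix.toLin'_pow, _root_.smul_pow, hP, inv_pow, he, smul_smul, inv_mul_cancel₀ hP0, one_smul,
      Matrix.toLin'_one]
    rfl
  obtain ⟨α, β, hαβ, u, v, hu, hv, hTu, hTv⟩ :=
    exists_eigenvectors_of_pow_eq_one hn.pos hζ hT fun s hs ↦ by
      have hMs : ∀ v, M.mulVec v = (e * s) • v := fun v ↦ by
        have := congrArg (e • ·) (LinearMap.congr_fun hs v)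
        simpa [Matrix.smul_mulVec, smul_smul, he0] using this
      have h0 := hMs ![1, 0]
      have h1 := hMs ![0, 1]
      simp only [M, Matrix.mulVec, dotProduct, Fin.sum_univ_two, funext_iff, Fin.forall_fin_two,
        Matrix.of_apply, Matrix.cons_val', Matrix.cons_val_zero, Matrix.cons_val_one,
        Matrix.cons_val_fin_one, Pi.smul_apply, smul_eq_mul, mul_one, mul_zero, add_zero,
        zero_add] at h0 h1
      refine hσ1 (algEquiv_eq_of_apply_generator_eq hytop (mul_right_cancel₀ hw ?_))
      rw [hσy, hwdef, h0.2, h1.1, h1.2, h0.1, AlgEquiv.one_apply]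
      simp [mul_comm]
  have heig : ∀ {γ : F} {v : Fin 2 → F}, Matrix.toLin' (e⁻¹ • M) v = γ • v →
      w * σ (ι v) = algebraMap F L (e * γ) * ι v := fun {γ v} h ↦ by
    rw [← hM]
    have : M.mulVec v = (e * γ) • v := by
      have := congrArg (e • ·) h
      simpa [Matrix.smul_mulVec, smul_smul, he0] using this
    rw [this]
    simp [ι]; ring
  have hu' := heig hTu
  have hv' := heig hTv
  have hιu : ι u ≠ 0 := mt (hι0 u) hu
  have hιv : ι v ≠ 0 := mt (hι0 v) hv
  have hβ : β ≠ 0 := by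
    rintro rfl
    simp [hw, hιv] at hv'
  have hσz : σ (ι u / ι v) = algebraMap F L (α / β) * (ι u / ι v) := by
    rw [map_div₀, ← mul_div_mul_left _ _ hw, hu', hv', mul_div_mul_comm, ← map_div₀,
      mul_div_mul_left _ _ he0]
  have hab : α / β ≠ 1 := fun h ↦ hαβ ((div_eq_one_iff_eq hβ).1 h)
  set z := ι u / ι v with hz
  have hz0 : z ≠ 0 := div_ne_zero hιu hιv
  have hzconst : ∀ s, z ≠ algebraMap F L s := by
    rintro s hs
    rw [hs, AlgEquiv.commutes, ← hs] at hσz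
    refine hab ((algebraMap F L).injective (mul_right_cancel₀ hz0 ?_))
    rw [← hσz, map_one, one_mul]
  have hyz : y * (z * algebraMap F L (v 1) - algebraMap F L (u 1)) =
      algebraMap F L (u 0) - z * algebraMap F L (v 0) := by
    have : z * ι v = ι u := div_mul_cancel₀ _ hιv
    simp only [ι] at this
    linear_combination this
  have hden : z * algebraMap F L (v 1) - algebraMap F L (u 1) ≠ 0 := by
    intro h
    have h' := hyz
    rw [h, mul_zero] at h'
    by_cases h1 : v 1 = 0
    · have h0 : v 0 ≠ 0 := fun h0 ↦ hv (by ext i; fin_cases i <;> simp [h0, h1])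
      refine hzconst (u 0 / v 0) ?_
      rw [map_div₀, eq_div_iff (by simpa using h0)]
      linear_combination h'
    · refine hzconst (u 1 / v 1) ?_
      rw [map_div₀, eq_div_iff (by simpa using h1)]
      linear_combination h
  have hztop : F⟮z⟯ = ⊤ := by
    rw [← top_le_iff, ← hytop, adjoin_simple_le_iff, eq_div_of_mul_eq hden hyz]
    have hz := mem_adjoin_simple_self F z
    exact div_mem (sub_mem (_root_.algebraMap_mem _ _) (mul_mem hz (_root_.algebraMap_mem _ _)))
      (sub_mem (mul_mem hz (_root_.algebraMap_mem _ _)) (_root_.algebraMap_mem _ _))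
  refine ⟨z, α / β, fun hzalg ↦ hy ?_, hztop, hab, hσz⟩
  have := isAlgebraic_adjoin_simple hzalg.isIntegral
  rw [hztop] at this
  exact (isAlgebraic_iff (K := F) (S := (⊤ : IntermediateField F L)) (x := ⟨y, mem_top⟩)).1
    (this.isAlgebraic _)

/-- An elementary abelian `p`-group of automorphisms of a purely transcendental extension of
transcendence degree one is cyclic, for `p` odd and `F` containing the `p`-th roots of unity. -/
theorem card_le_of_injective_algEquiv {y : L} (hy : Transcendental F y) (hytop : F⟮y⟯ = ⊤)
    {p : ℕ} (hp : Odd p) {ζ : F} (hζ : IsPrimitiveRoot ζ p) {H : Type*} [Group H]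
    (φ : H →* (L ≃ₐ[F] L)) (hφ : Function.Injective φ) (hcomm : ∀ g h : H, g * h = h * g)
    (hpow : ∀ g : H, g ^ p = 1) : Nat.card H ≤ p := by
  by_cases hex : ∃ g : H, g ≠ 1
  swap
  · push Not at hex
    have : Subsingleton H := ⟨fun g h ↦ (hex g).trans (hex h).symm⟩
    exact Finite.card_le_one_iff_subsingleton.2 this |>.trans hp.pos
  obtain ⟨g, hg⟩ := hex
  obtain ⟨z, a, hz, hztop, ha, hgz⟩ := exists_generator_apply_eq_smul hy hytop hp hζ
    (σ := φ g) (by rw [← map_pow, hpow, map_one]) ((map_ne_one_iff φ hφ).2 hg)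
  have hz0 : z ≠ 0 := fun h ↦ hz (h ▸ isAlgebraic_zero)
  have hap : ∀ (h : H) (b : F), φ h z = algebraMap F L b * z → b ^ p = 1 := by
    intro h b hb
    have hm : ∀ m : ℕ, (φ h ^ m) z = algebraMap F L (b ^ m) * z := by
      intro m
      induction m with
      | zero => simp
      | succ m ih =>
        rw [pow_succ, AlgEquiv.mul_apply, hb, map_mul, AlgEquiv.commutes, ih, pow_succ, map_mul]
        ring
    have := hm p
    rw [← map_pow, hpow, map_one, AlgEquiv.one_apply] at this
    refine (algebraMap F L).injective (mul_right_cancel₀ hz0 ?_)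
    rw [← this, map_one, one_mul]
  have ha2 : a ^ 2 ≠ 1 := fun h2 ↦ by
    obtain ⟨m, hm⟩ := hp
    have := hap g a hgz
    rw [hm, pow_succ, pow_mul, h2, one_pow, one_mul] at this
    exact ha this
  have ha0 : a ≠ 0 := fun h0 ↦ by
    have := hap g a hgz
    rw [h0, zero_pow hp.pos.ne'] at this
    exact zero_ne_one this
  have hscal : ∀ h : H, ∃ b : F, φ h z = algebraMap F L b * z := by
    intro h
    obtain ⟨A, B, C, D, hdet, hw, hhz⟩ := exists_moebius hz hztop
      (transcendental_algEquiv_apply hz (φ h)) (adjoin_simple_algEquiv_eq_top (φ h) hztop)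
    have hcz : φ g (φ h z) = algebraMap F L a * φ h z := by
      rw [← AlgEquiv.mul_apply, ← map_mul, hcomm, map_mul, AlgEquiv.mul_apply, hgz, map_mul,
        AlgEquiv.commutes]
    have hhz' := congrArg (φ g) hhz
    simp only [map_mul, map_add, AlgEquiv.commutes, hcz, hgz] at hhz'
    obtain ⟨h0, h1, h2⟩ := hz.coeff_eq_zero_of_quadratic (a := B * D * (a - 1))
      (b := B * C * (a ^ 2 - 1)) (c := A * C * (a ^ 2 - a)) (by
        simp only [map_mul, map_sub, map_pow, map_one]
        linear_combination (algebraMap F L C * z + algebraMap F L D) * hhz' -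
          algebraMap F L a * (algebraMap F L C * (algebraMap F L a * z) + algebraMap F L D) * hhz)
    have hBC : B * C = 0 := (mul_eq_zero.1 h1).resolve_right (sub_ne_zero.2 ha2)
    have hAD : A * D ≠ 0 := fun h ↦ hdet (by rw [h, hBC, sub_zero])
    have hA := left_ne_zero_of_mul hAD
    have hD := right_ne_zero_of_mul hAD
    have hB : B = 0 := by simpa [hD, sub_eq_zero, ha] using h0
    have hC : C = 0 := by
      have : a ^ 2 - a ≠ 0 := by
        rw [pow_two, ← mul_sub_one]; exact mul_ne_zero ha0 (sub_ne_zero.2 ha)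
      simpa [hA, this] using h2
    refine ⟨A / D, ?_⟩
    rw [map_div₀, div_mul_eq_mul_div, eq_div_iff (by simpa using hD)]
    simpa [hB, hC] using hhz
  choose f hf using hscal
  let toRoot : H → nthRootsFinset p (1 : F) := fun h ↦
    ⟨f h, (mem_nthRootsFinset hp.pos _).2 (hap h _ (hf h))⟩
  have htoRoot : Function.Injective toRoot := fun h h' hh ↦ by
    have : f h = f h' := congrArg Subtype.val hh
    exact hφ (algEquiv_eq_of_apply_generator_eq hztop (by rw [hf, hf, this]))
  refine (Nat.card_le_card_of_injective toRoot htoRoot).trans ?_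
  rw [Nat.card_eq_fintype_card, Fintype.card_coe, hζ.card_nthRootsFinset]

end Moebius

section FunctionField

open IntermediateField.algebraAdjoinAdjoin in
theorem transcendental_adjoin_of_algebraAdjoin {F E : Type*} [Field F] [Field E] [Algebra F E]
    {s : Set E} {x : E} (h : Transcendental (Algebra.adjoin F s) x) :
    Transcendental (IntermediateField.adjoin F s) x := fun halg ↦
  h ((IsFractionRing.isAlgebraic_iff _ (IntermediateField.adjoin F s) E).2 halg)

variable (k : Type*) [Field k]

theorem adjoin_Kx_Xv_one_eq_top : (Kx k)⟮Xv k 1⟯ = ⊤ := by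
  have hmem : ∀ q : MvPolynomial (Fin 2) k, algebraMap _ (Kxy k) q ∈ (Kx k)⟮Xv k 1⟯ := by
    intro q
    induction q using MvPolynomial.induction_on with
    | C a =>
      have : algebraMap (MvPolynomial (Fin 2) k) (Kxy k) (MvPolynomial.C a) =
          algebraMap (Kx k) (Kxy k) (algebraMap k (Kx k) a) := by
        rw [← IsScalarTower.algebraMap_apply, ← MvPolynomial.algebraMap_eq,
          ← IsScalarTower.algebraMap_apply]
      rw [this]
      exact _root_.algebraMap_mem _ _
    | add q r hq hr => rw [map_add]; exact add_mem hq hr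
    | mul_X q i hq =>
      rw [map_mul]
      refine mul_mem hq ?_
      fin_cases i
      · exact _root_.algebraMap_mem (Kx k)⟮Xv k 1⟯
          (⟨Xv k 0, mem_adjoin_simple_self k _⟩ : Kx k)
      · exact mem_adjoin_simple_self _ _
  refine top_le_iff.1 fun f _ ↦ ?_
  obtain ⟨q, r, -, rfl⟩ := IsFractionRing.div_surjective (A := MvPolynomial (Fin 2) k) f
  exact div_mem (hmem q) (hmem r)

theorem algebraicIndependent_Xv : AlgebraicIndependent k (Xv k) :=
  (MvPolynomial.algebraicIndependent_X (Fin 2) k).map' (f := IsScalarTower.toAlgHom k _ (Kxy k))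
    (IsFractionRing.injective _ _)

theorem transcendental_Kx_Xv_one : Transcendental (Kx k) (Xv k 1) := by
  have h := ((AlgebraicIndependent.iff_transcendental_adjoin_image 1).1
    (algebraicIndependent_Xv k)).2
  rw [show ({1}ᶜ : Set (Fin 2)) = {0} by ext i; fin_cases i <;> simp, Set.image_singleton] at h
  exact transcendental_adjoin_of_algebraAdjoin h

theorem transcendental_AdjoinSimple_gen : Transcendental k (AdjoinSimple.gen k (Xv k 0)) := by
  intro h
  exact (algebraicIndependent_Xv k).transcendental 0
    ((isAlgebraic_algHom_iff (Kx k).val Subtype.val_injective).2 h)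

theorem adjoin_AdjoinSimple_gen_eq_top {F E : Type*} [Field F] [Field E] [Algebra F E] (x : E) :
    F⟮AdjoinSimple.gen F x⟯ = ⊤ := by
  apply lift_injective
  rw [lift_adjoin_simple, lift_top]
  rfl

end FunctionField

/-- The restriction of automorphisms preserving an intermediate field. -/
def restrictStableHom {F E : Type*} [Field F] [Field E] [Algebra F E] (K : IntermediateField F E)
    (G : Subgroup (E ≃ₐ[F] E)) (hG : ∀ σ ∈ G, ∀ x ∈ K, σ x ∈ K) : G →* (K ≃ₐ[F] K) where
  toFun σ := AlgEquiv.ofAlgHom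
    (((σ : E ≃ₐ[F] E) : E →ₐ[F] E).comp K.val |>.codRestrict K.toSubalgebra
      fun x ↦ hG σ σ.2 x x.2)
    ((((σ⁻¹ : G) : E ≃ₐ[F] E) : E →ₐ[F] E).comp K.val |>.codRestrict K.toSubalgebra
      fun x ↦ hG _ (σ⁻¹).2 x x.2)
    (by ext x; exact congrArg (· x) (mul_inv_cancel (σ : E ≃ₐ[F] E)))
    (by ext x; exact congrArg (· x) (inv_mul_cancel (σ : E ≃ₐ[F] E)))
  map_one' := by ext x; rfl
  map_mul' σ τ := by ext x; rfl

/-- `k` algebraically closed, `p` an odd prime `≠ char k`, `G ≤ Aut_k(k(x,y))`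
whose elements all map `k(x)` onto itself (i.e. `G ≤ Aut(ℙ¹_{k(t)})`). If `G ≅ (ℤ/p)^r`
then `r ≤ 2`. -/
theorem p_elementary_P1_fibration_rank_le_two
    (k : Type*) [Field k] [IsAlgClosed k]
    (p : ℕ) (hp : p.Prime) (hodd : Odd p) (hchar : ringChar k ≠ p)
    (r : ℕ) (G : Subgroup (Kxy k ≃ₐ[k] Kxy k))
    (hGx : ∀ σ ∈ G, (⇑σ) '' (Kx k : Set (Kxy k)) = (Kx k : Set (Kxy k)))
    (hG : Nonempty (G ≃* Multiplicative (Fin r → ZMod p))) :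
    r ≤ 2 := by
  obtain ⟨e⟩ := hG
  have : Fact p.Prime := ⟨hp⟩
  have hcomm : ∀ g h : G, g * h = h * g := fun g h ↦ e.injective (by simp [mul_comm])
  have hpow : ∀ g : G, g ^ p = 1 := fun g ↦ e.injective <| by
    rw [map_pow, map_one]
    refine Multiplicative.toAdd.injective (funext fun i ↦ ?_)
    simp
  have hcard : Nat.card G = p ^ r := by
    rw [Nat.card_congr e.toEquiv, Nat.card_congr Multiplicative.toAdd]
    simp
  have hpk : NeZero (p : k) := ⟨fun h ↦ hchar (by
    have := (Nat.dvd_prime hp).1 (ringChar.dvd h)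
    exact this.resolve_left (CharP.ringChar_ne_one))⟩
  obtain ⟨ζ, hζ⟩ := HasEnoughRootsOfUnity.exists_primitiveRoot k p
  let ρ := restrictStableHom (Kx k) G fun σ hσ x hx ↦ (hGx σ hσ).subset ⟨x, hx, rfl⟩
  have hrange : Nat.card ρ.range ≤ p :=
    card_le_of_injective_algEquiv (transcendental_AdjoinSimple_gen k)
      (adjoin_AdjoinSimple_gen_eq_top _) hodd hζ ρ.range.subtype ρ.range.subtype_injective
      (by
        rintro ⟨-, g, rfl⟩ ⟨-, h, rfl⟩
        exact Subtype.ext (by simp [← map_mul, hcomm g h]))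
      (by
        rintro ⟨-, g, rfl⟩
        exact Subtype.ext (by simp [← map_pow, hpow g]))
  have hker : Nat.card ρ.ker ≤ p := by
    have hfix : ∀ g : ρ.ker, (g : Kxy k ≃ₐ[k] Kxy k) ∈ (Kx k).fixingSubgroup := by
      intro g x
      exact congrArg Subtype.val (DFunLike.congr_fun (MonoidHom.mem_ker.1 g.2) x)
    refine card_le_of_injective_algEquiv (transcendental_Kx_Xv_one k) (adjoin_Kx_Xv_one_eq_top k)
      hodd (hζ.map_of_injective (algebraMap k (Kx k)).injective)
      ((fixingSubgroupEquiv (Kx k)).toMonoidHom.comp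
        ((G.subtype.comp ρ.ker.subtype).codRestrict (Kx k).fixingSubgroup hfix))
      ((fixingSubgroupEquiv (Kx k)).injective.comp fun g h hgh ↦
        Subtype.ext <| Subtype.ext <|
          congrArg (fun f : (Kx k).fixingSubgroup ↦ (f : Kxy k ≃ₐ[k] Kxy k)) hgh)
      (fun g h ↦ Subtype.ext (hcomm _ _)) (fun g ↦ Subtype.ext (hpow _))
  have hle : p ^ r ≤ p ^ 2 := by
    rw [← hcard, ← ρ.ker.card_mul_index, Subgroup.index_ker, pow_two]
    exact Nat.mul_le_mul hker hrange
  exact (Nat.pow_le_pow_iff_right hp.one_lt).1 hle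
end

section
/- Let k be an algebraically closed field, n a positive integer, and p a prime with p ≠ char(k) and p not dividing n. If G is a subgroup of PGL_n(k) isomorphic to (ℤ/p)^r, then r ≤ n − 1. -/
open Module

/-- A commuting family of endomorphisms of order dividing `p`, indexed injectively, has at most
`p ^ dim V` members. -/
theorem Module.End.card_le_pow_finrank_of_commute_of_pow_eq_one {k V ι : Type*} [Field k] [IsAlgClosed k]
    [AddCommGroup V] [Module k V] [FiniteDimensional k V] {p : ℕ} (hp : (p : k) ≠ 0)
    (f : ι → End k V) (hf : Function.Injective f) (hcomm : ∀ i j, Commute (f i) (f j))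
    (hpow : ∀ i, f i ^ p = 1) :
    Nat.card ι ≤ p ^ finrank k V := by
  have hp0 : p ≠ 0 := by
    rintro rfl
    simp at hp
  have hss (i : ι) : (f i).IsSemisimple :=
    End.isSemisimple_of_squarefree_aeval_eq_zero
      (Polynomial.separable_X_pow_sub_C (1 : k) hp one_ne_zero).squarefree (by simp [hpow i])
  let W : (ι → k) → Submodule k V := fun χ ↦ ⨅ i, (f i).eigenspace (χ i)
  have hW (χ : ι → k) : ⨅ i, (f i).maxGenEigenspace (χ i) = W χ := by
    simp only [W, (hss _).isFinitelySemisimple.maxGenEigenspace_eq_eigenspace]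
  have hind : iSupIndep W := by
    have := End.independent_iInf_maxGenEigenspace_of_forall_mapsTo f
      fun i j ↦ End.mapsTo_maxGenEigenspace_of_comm (hcomm j i)
    simpa only [hW] using this
  have htop : ⨆ χ, W χ = ⊤ := by
    have := End.iSup_iInf_maxGenEigenspace_eq_top_of_iSup_maxGenEigenspace_eq_top_of_commute f
      (fun i j _ ↦ hcomm i j) fun i ↦ End.iSup_maxGenEigenspace_eq_top (f i)
    simpa only [hW] using this
  let S := {χ // W χ ≠ ⊥}
  have hfin : Fintype S := hind.fintypeNeBotOfFiniteDimensional
  have hS : Fintype.card S ≤ finrank k V := hind.subtype_ne_bot_le_finrank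
  have hmem {χ : ι → k} {v : V} (hv : v ∈ W χ) (i : ι) : f i v = χ i • v :=
    End.mem_eigenspace_iff.mp ((Submodule.mem_iInf _).mp hv i)
  have hroot (χ : S) (i : ι) : χ.1 i ^ p = 1 := by
    obtain ⟨v, hv, hv0⟩ := Submodule.exists_mem_ne_zero_of_ne_bot χ.2
    have h : (f i ^ p) v = χ.1 i ^ p • v :=
      End.HasEigenvector.pow_apply ⟨End.mem_eigenspace_iff.mpr (hmem hv i), hv0⟩ p
    rw [hpow, End.one_apply] at h
    exact smul_left_injective k hv0 (by simpa using h.symm)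
  have : NeZero p := ⟨hp0⟩
  let e : ι → S → rootsOfUnity p k := fun i χ ↦ rootsOfUnity.mkOfPowEq (χ.1 i) (hroot χ i)
  have he : Function.Injective e := by
    intro i j hij
    apply hf
    have hle : ⨆ χ, W χ ≤ LinearMap.eqLocus (f i) (f j) := by
      refine iSup_le fun χ v hv ↦ ?_
      by_cases hχ : W χ = ⊥
      · simp_all
      · have h := congr_arg (fun x : rootsOfUnity p k ↦ ((x : kˣ) : k)) (congr_fun hij ⟨χ, hχ⟩)
        simp only [e, rootsOfUnity.coe_mkOfPowEq] at h
        rw [LinearMap.mem_eqLocus, hmem hv, hmem hv, h]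
    rw [htop] at hle
    exact LinearMap.ext fun v ↦ hle (Submodule.mem_top (x := v))
  calc Nat.card ι ≤ Nat.card (S → rootsOfUnity p k) := Nat.card_le_card_of_injective e he
    _ = Nat.card (rootsOfUnity p k) ^ Fintype.card S := by simp [Nat.card_fun]
    _ ≤ p ^ Fintype.card S := Nat.pow_le_pow_left (by simpa using card_rootsOfUnity k p) _
    _ ≤ p ^ finrank k V := Nat.pow_le_pow_right (Nat.pos_of_ne_zero hp0) hS

namespace Matrix.GeneralLinearGroup

variable {k : Type*} [Field k] {n : ℕ}

/-- If `A` and `B` commute modulo scalars and `A ^ p` is scalar with `p` coprime to the size,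
then `A` and `B` commute. -/
theorem commute_of_commute_mk {p : ℕ} (hpn : p.Coprime n) {A B : GL (Fin n) k} (hA : A ^ p = 1)
    (hAB : Commute (A : PGL n k) (B : PGL n k)) : Commute A B := by
  have hz : (A * B)⁻¹ * (B * A) ∈ Subgroup.center (GL (Fin n) k) :=
    QuotientGroup.eq.mp (by simpa using hAB.eq)
  obtain ⟨u, hu⟩ : ∃ u, scalar (Fin n) u = (A * B)⁻¹ * (B * A) := by
    rwa [center_eq_range_scalar] at hz
  have hBA : B * A * B⁻¹ = A * scalar (Fin n) u := by
    have hc := Subgroup.mem_center_iff.mp (hu ▸ hz) B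
    rw [mul_inv_eq_iff_eq_mul, mul_assoc, ← hc, ← mul_assoc, hu]
    group
  have hcomm : Commute A (scalar (Fin n) u) := Subgroup.mem_center_iff.mp (hu ▸ hz) A
  rcases Nat.eq_zero_or_pos n with rfl | hn
  · exact Subsingleton.elim _ _
  have : Nonempty (Fin n) := ⟨⟨0, hn⟩⟩
  have hup : u ^ p = 1 := by
    have h := congr_arg (· ^ p) hBA
    simp only [conj_pow, hA, hcomm.mul_pow, mul_one, one_mul, mul_inv_cancel, ← map_pow] at h
    have h' := congr_arg (fun M : GL (Fin n) k ↦ (M : Matrix (Fin n) (Fin n) k) ⟨0, hn⟩ ⟨0, hn⟩) h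
    exact Units.ext (by simpa [Matrix.diagonal_pow] using h'.symm)
  have hun : u ^ n = 1 := by
    have h := congr_arg det hBA
    rw [map_mul, map_mul, map_mul, map_inv, mul_right_comm, mul_inv_cancel, one_mul,
      left_eq_mul] at h
    simpa using h
  have hu1 : u = 1 := by
    simpa [hpn] using pow_gcd_eq_one.mpr ⟨hup, hun⟩
  rw [hu1, map_one, mul_one, mul_inv_eq_iff_eq_mul] at hBA
  exact hBA.symm

/-- Over an algebraically closed field, a class of exponent `p` in `PGL` lifts to a matrix of
exponent `p`. -/
theorem exists_pow_eq_one_of_mk_pow_eq_one [IsAlgClosed k] {p : ℕ} (hp : p ≠ 0) (g : PGL n k)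
    (hg : g ^ p = 1) : ∃ A : GL (Fin n) k, (A : PGL n k) = g ∧ A ^ p = 1 := by
  obtain ⟨A, rfl⟩ := QuotientGroup.mk_surjective g
  rw [← QuotientGroup.mk_pow, QuotientGroup.eq_one_iff] at hg
  obtain ⟨u, hu⟩ : ∃ u, scalar (Fin n) u = A ^ p := by
    rwa [center_eq_range_scalar] at hg
  obtain ⟨z, hz⟩ := IsAlgClosed.exists_pow_nat_eq (u : k) (Nat.pos_of_ne_zero hp)
  have hz0 : z ≠ 0 := by
    rintro rfl
    exact u.ne_zero (by rw [← hz, zero_pow hp])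
  have hw : (Units.mk0 z hz0) ^ p = u := Units.ext (by simpa using hz)
  have hc : scalar (Fin n) (Units.mk0 z hz0)⁻¹ ∈ Subgroup.center (GL (Fin n) k) := by
    rw [center_eq_range_scalar]
    exact ⟨_, rfl⟩
  refine ⟨A * scalar (Fin n) (Units.mk0 z hz0)⁻¹, ?_, ?_⟩
  · rw [QuotientGroup.mk_mul, (QuotientGroup.eq_one_iff _).mpr hc, mul_one]
  · rw [Commute.mul_pow (Subgroup.mem_center_iff.mp hc A), ← hu, ← map_pow, ← map_mul, inv_pow, hw,
      mul_inv_cancel, map_one]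

end Matrix.GeneralLinearGroup

open Matrix.GeneralLinearGroup in
/-- `k` algebraically closed, `n ≥ 1`, `p` a prime with `p ≠ char k` and
`p ∤ n`.  If `G ≤ PGL_n(k)` is isomorphic to `(ℤ/p)^r` then `r ≤ n - 1`. -/
theorem p_elementary_PGLn_rank_le
    (k : Type*) [Field k] [IsAlgClosed k]
    (n : ℕ) (hn : 0 < n)
    (p : ℕ) (hp : p.Prime) (hchar : ringChar k ≠ p) (hpn : ¬ p ∣ n)
    (r : ℕ) (G : Subgroup (PGL n k))
    (hG : Nonempty (G ≃* Multiplicative (Fin r → ZMod p))) :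
    r ≤ n - 1 := by
  obtain ⟨φ⟩ := hG
  have hpk : (p : k) ≠ 0 := by
    rw [Ne, ringChar.spec]
    intro h
    rcases (Nat.dvd_prime hp).mp h with h1 | h1
    · exact CharP.ringChar_ne_one h1
    · exact hchar h1
  have : NeZero p := ⟨hp.ne_zero⟩
  have : NeZero (p : k) := ⟨hpk⟩
  have : Nonempty (Fin n) := ⟨⟨0, hn⟩⟩
  have hexp (g : G) : (g : PGL n k) ^ p = 1 := by
    have h : g ^ p = 1 := φ.injective <| by
      rw [map_pow, map_one]
      exact Multiplicative.toAdd.injective (by ext; simp)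
    simpa using congr_arg Subtype.val h
  have hcommG (g h : G) : Commute (g : PGL n k) (h : PGL n k) := by
    have : g * h = h * g := φ.injective (by rw [map_mul, map_mul, mul_comm])
    exact congr_arg Subtype.val this
  choose A hA hAp using fun g : G ↦
    exists_pow_eq_one_of_mk_pow_eq_one hp.ne_zero (g : PGL n k) (hexp g)
  let B : G × rootsOfUnity p k → GL (Fin n) k := fun x ↦ scalar (Fin n) x.2 * A x.1
  have hc (u : kˣ) : scalar (Fin n) u ∈ Subgroup.center (GL (Fin n) k) := by
    rw [center_eq_range_scalar]
    exact ⟨_, rfl⟩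
  have hB (x) : (B x : PGL n k) = x.1 := by
    rw [QuotientGroup.mk_mul, (QuotientGroup.eq_one_iff _).mpr (hc _), one_mul, hA]
  have hBp (x) : B x ^ p = 1 := by
    rw [Commute.mul_pow (Subgroup.mem_center_iff.mp (hc _) _).symm, hAp, mul_one, ← map_pow,
      (mem_rootsOfUnity _ _).mp x.2.2, map_one]
  have hBcomm (x y) : Commute (B x) (B y) :=
    commute_of_commute_mk ((Nat.Prime.coprime_iff_not_dvd hp).mpr hpn) (hBp x)
      (by rw [hB, hB]; exact hcommG _ _)
  have hBinj : Function.Injective B := by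
    rintro ⟨g, u⟩ ⟨h, v⟩ hxy
    obtain rfl : g = h := Subtype.ext (by rw [← hB (g, u), ← hB (h, v), hxy])
    have h1 := congr_arg (fun M : GL (Fin n) k ↦ (M : Matrix (Fin n) (Fin n) k) ⟨0, hn⟩ ⟨0, hn⟩)
      (mul_right_cancel hxy)
    have : u = v := Subtype.ext (Units.ext (by simpa using h1))
    rw [this]
  have hcard := Module.End.card_le_pow_finrank_of_commute_of_pow_eq_one hpk
    (fun x ↦ Matrix.toLinAlgEquiv' (B x : Matrix (Fin n) (Fin n) k))
    (Matrix.toLinAlgEquiv'.injective.comp (Units.val_injective.comp hBinj))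
    (fun x y ↦ ((hBcomm x y).map (Units.coeHom _)).map Matrix.toLinAlgEquiv')
    (fun x ↦ by rw [← map_pow, ← Units.val_pow_eq_pow_val, hBp, Units.val_one, map_one])
  have hGcard : Nat.card G = p ^ r := by
    rw [Nat.card_congr φ.toEquiv, Nat.card_congr Multiplicative.toAdd, Nat.card_fun]
    simp
  rw [Nat.card_prod, hGcard, HasEnoughRootsOfUnity.natCard_rootsOfUnity, ← pow_succ,
    Module.finrank_fin_fun] at hcard
  have := (Nat.pow_le_pow_iff_right hp.one_lt).mp hcard
  omega
end

section
/- Let k be an algebraically closed field and p a prime with p ≠ char(k). Let H be the semidirect product (PGL_2(k) × PGL_2(k)) ⋊ ℤ/2, where the nontrivial element of ℤ/2 acts on PGL_2(k) × PGL_2(k) by exchanging the two factors. Let G be a subgroup of H isomorphic to (ℤ/p)^r which is not contained in the base subgroup PGL_2(k) × PGL_2(k). Then p = 2 and r ≤ 3. -/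
/-- `PGL_2(k)`: the quotient of `GL_2(k)` by its center. -/
abbrev PGL2 (k : Type*) [Field k] :=
  Matrix.GeneralLinearGroup (Fin 2) k ⧸ Subgroup.center (Matrix.GeneralLinearGroup (Fin 2) k)

/-- The automorphism of `PGL_2(k) × PGL_2(k)` exchanging the two factors. -/
def swapAut (k : Type*) [Field k] : MulAut (PGL2 k × PGL2 k) :=
  MulEquiv.prodComm

/-- The action of `ℤ/2` on `PGL_2(k) × PGL_2(k)` in which the nontrivial element
exchanges the two factors. -/
def swapHom (k : Type*) [Field k] :
    Multiplicative (ZMod 2) →* MulAut (PGL2 k × PGL2 k) where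
  toFun x := if x.toAdd = 0 then 1 else swapAut k
  map_one' := by simp
  map_mul' := by
    intro a b
    have h : ∀ x : Multiplicative (ZMod 2), x.toAdd = 0 ∨ x.toAdd = 1 := by decide
    have hsw : swapAut k * swapAut k = 1 := by
      ext x <;> rfl
    rcases h a with ha | ha <;> rcases h b with hb | hb <;>
      simp [toAdd_mul, ha, hb, hsw, show (1 : ZMod 2) + 1 = 0 from rfl]

namespace PGL2

variable {k : Type*} [Field k]

/-- A representative of an element of order two in `PGL_2(k)` is traceless. -/
theorem trace_eq_zero_of_sq_mem_center {M : GL (Fin 2) k}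
    (hsq : M * M ∈ Subgroup.center (GL (Fin 2) k))
    (hM : M ∉ Subgroup.center (GL (Fin 2) k)) : (M : Matrix (Fin 2) (Fin 2) k).trace = 0 := by
  rw [Matrix.GeneralLinearGroup.mem_center_iff_val_mem_range_scalar] at hsq hM
  obtain ⟨c, hc⟩ := hsq
  by_contra ht
  refine hM ⟨(c + M.val.det) / M.val.trace, ?_⟩
  have hch : M.val * M.val = M.val.trace • M.val - M.val.det • 1 := by
    rw [Matrix.trace_fin_two, Matrix.det_fin_two]
    ext i j
    fin_cases i <;> fin_cases j <;> simp [Matrix.mul_apply, Fin.sum_univ_two] <;> ring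
  rw [Units.val_mul, hch, Matrix.scalar_apply, ← Matrix.smul_one_eq_diagonal] at hc
  rw [Matrix.scalar_apply, ← Matrix.smul_one_eq_diagonal, div_eq_inv_mul, mul_smul, add_smul, hc,
    sub_add_cancel, inv_smul_smul₀ ht]

/-- A group of exponent two embedding in `PGL_2(k)`, `char k ≠ 2`, has at most four elements:
its elements lift to an orthogonal family for the trace form on the `2 × 2` matrices. -/
theorem card_le_four_of_injective {K : Type*} [Group K] [Finite K] (h2 : (2 : k) ≠ 0)
    (hK : ∀ x : K, x * x = 1) (φ : K →* PGL2 k) (hφ : Function.Injective φ) :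
    Nat.card K ≤ 4 := by
  have := Fintype.ofFinite K
  choose M hM using fun x : K ↦ QuotientGroup.mk_surjective (φ x)
  have hmem : ∀ x y : K, M x * M y ∈ Subgroup.center (GL (Fin 2) k) ↔ x * y = 1 := by
    intro x y
    rw [← QuotientGroup.eq_one_iff, QuotientGroup.mk_mul, hM, hM, ← map_mul, map_eq_one_iff φ hφ]
  have hortho : ∀ x y : K, x ≠ y → ((M x).val * (M y).val).trace = 0 := by
    intro x y hxy
    rw [← Units.val_mul]
    refine trace_eq_zero_of_sq_mem_center ?_ fun h ↦ ?_
    · rw [← QuotientGroup.eq_one_iff]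
      simp only [QuotientGroup.mk_mul, hM, ← map_mul, hK, map_one]
    · exact hxy (mul_right_cancel (((hmem x y).1 h).trans (hK y).symm))
  have hself : ∀ x : K, ((M x).val * (M x).val).trace ≠ 0 := by
    intro x
    obtain ⟨c, hc⟩ := Matrix.GeneralLinearGroup.mem_center_iff_val_mem_range_scalar.1
      ((hmem x x).2 (hK x))
    have hunit := (M x * M x).isUnit
    rw [← hc] at hunit
    rw [← Units.val_mul, ← hc]
    have hc0 : c ≠ 0 := by
      rintro rfl
      simp at hunit
    simpa [Matrix.trace_fin_two, ← two_mul] using ⟨h2, hc0⟩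
  have hli : LinearIndependent k fun x : K ↦ (M x).val :=
    LinearMap.linearIndependent_of_isOrthoᵢ
      (B := (LinearMap.mul k (Matrix (Fin 2) (Fin 2) k)).compr₂ (Matrix.traceLinearMap (Fin 2) k k))
      (fun x y hxy ↦ hortho x y hxy) hself
  simpa [Module.finrank_matrix] using hli.fintype_card_le_finrank

end PGL2

section SwapProduct

variable {k : Type*} [Field k]

/-- An element of the base commuting with an element outside the base is determined by its first
component. -/
theorem eq_one_of_commute_of_left_fst_eq_one
    {g x : (PGL2 k × PGL2 k) ⋊[swapHom k] Multiplicative (ZMod 2)}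
    (hg : g.right ≠ 1) (hx : x.right = 1) (hcomm : g * x = x * g) (hx1 : x.left.1 = 1) :
    x = 1 := by
  have hswap : swapHom k g.right = swapAut k := if_neg fun h ↦ hg (by simpa using h)
  have h1 := congrArg (fun z ↦ z.left.1) hcomm
  simp only [SemidirectProduct.mul_left, hswap, hx, map_one, MulAut.one_apply, Prod.fst_mul, hx1,
    one_mul] at h1
  have hx2 : x.left.2 = 1 := mul_eq_left.1 h1
  exact SemidirectProduct.ext (Prod.ext hx1 hx2) hx

end SwapProduct

/-- `k` algebraically closed, `p` a prime `≠ char k`,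
`H = (PGL_2(k) × PGL_2(k)) ⋊ ℤ/2` (the automorphism group of `ℙ¹ × ℙ¹`).
If `G ≤ H` is isomorphic to `(ℤ/p)^r` and not contained in the base subgroup
`PGL_2(k) × PGL_2(k)`, then `p = 2` and `r ≤ 3`. -/
theorem p_elementary_P1xP1_not_in_base
    (k : Type*) [Field k] [IsAlgClosed k]
    (p : ℕ) (hp : p.Prime) (hchar : ringChar k ≠ p)
    (r : ℕ)
    (G : Subgroup (SemidirectProduct (PGL2 k × PGL2 k) (Multiplicative (ZMod 2)) (swapHom k)))
    (hG : Nonempty (G ≃* Multiplicative (Fin r → ZMod p)))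
    (hbase : ¬ G ≤ (SemidirectProduct.inl :
      PGL2 k × PGL2 k →* SemidirectProduct (PGL2 k × PGL2 k) (Multiplicative (ZMod 2)) (swapHom k)).range) :
    p = 2 ∧ r ≤ 3 := by
  obtain ⟨e⟩ := hG
  have hpow : ∀ x : G, x ^ p = 1 := by
    intro x
    apply e.injective
    rw [map_pow, map_one]
    refine Multiplicative.toAdd.injective (funext fun i ↦ ?_)
    simp
  have hcomm : ∀ x y : G, x * y = y * x := fun x y ↦
    e.injective (by rw [map_mul, map_mul, mul_comm])
  rw [SemidirectProduct.range_inl_eq_ker_rightHom, SetLike.not_le_iff_exists] at hbase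
  obtain ⟨g, hgG, hg⟩ := hbase
  replace hg : g.right ≠ 1 := hg
  have hp2 : p = 2 := by
    have h1 : g.right ^ p = 1 := by
      have hgp : g ^ p = 1 := congrArg Subtype.val (hpow ⟨g, hgG⟩)
      rw [← SemidirectProduct.rightHom_eq_right, ← map_pow, hgp, map_one]
    have h2 : g.right ^ 2 = 1 := by
      generalize g.right = a
      revert a
      decide
    have hdvd : 2 ∣ p := orderOf_eq_prime h2 hg ▸ orderOf_dvd_of_pow_eq_one h1
    exact ((Nat.prime_dvd_prime_iff_eq Nat.prime_two hp).1 hdvd).symm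
  subst hp2
  refine ⟨rfl, ?_⟩
  have h2 : (2 : k) ≠ 0 := Ring.two_ne_zero hchar
  have : Finite G := Finite.of_equiv _ e.symm.toEquiv
  have hcard : Nat.card G = 2 ^ r := by
    rw [Nat.card_congr e.toEquiv]
    simp
  let ρ : G →* Multiplicative (ZMod 2) := SemidirectProduct.rightHom.comp G.subtype
  let φ : ρ.ker →* PGL2 k :=
    { toFun := fun x ↦ x.val.val.left.1
      map_one' := rfl
      map_mul' := fun x y ↦ by
        have hx : x.val.val.right = 1 := x.property
        simp [hx] }
  have hφ : Function.Injective φ := by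
    refine (injective_iff_map_eq_one φ).2 fun x hx ↦ Subtype.ext (Subtype.ext ?_)
    exact eq_one_of_commute_of_left_fst_eq_one hg x.property
      (congrArg Subtype.val (hcomm ⟨g, hgG⟩ x.val)) hx
  have hker := PGL2.card_le_four_of_injective h2
    (fun x : ρ.ker ↦ Subtype.ext (by simpa [sq] using hpow x.val)) φ hφ
  have hindex : ρ.ker.index ≤ 2 := by
    rw [Subgroup.index_ker]
    exact (Subgroup.card_le_card_group _).trans (by simp)
  have hle : 2 ^ r ≤ 2 ^ 3 := by
    rw [← hcard, ← ρ.ker.card_mul_index]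
    exact Nat.mul_le_mul hker hindex
  exact (Nat.pow_le_pow_iff_right (by norm_num)).1 hle
end

section
/- Let k be an algebraically closed field with char(k) ≠ 3, and let F ∈ k[X₀,X₁,X₂,X₃] be a nonzero homogeneous polynomial of degree 3. Assume: (i) for every quadruple (ε₀,ε₁,ε₂,ε₃) of elements of k with εᵢ³ = 1 for all i, there exists c ∈ k^* such that F(ε₀X₀, ε₁X₁, ε₂X₂, ε₃X₃) = c·F(X₀,X₁,X₂,X₃) (F is semi-invariant under the diagonal action of (μ₃)⁴); and (ii) the only common zero in k⁴ of the four partial derivatives ∂F/∂Xᵢ is the origin (the cubic surface F = 0 is smooth). Then there exist nonzero elements a₀, a₁, a₂, a₃ of k such that F = a₀X₀³ + a₁X₁³ + a₂X₂³ + a₃X₃³. -/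
open MvPolynomial

/-- Rescaling the variables by `ε` multiplies the coefficient at `m` by `∏ i, ε i ^ m i`. -/
theorem MvPolynomial.coeff_aeval_C_mul_X {σ R : Type*} [Fintype σ] [CommSemiring R]
    (ε : σ → R) (F : MvPolynomial σ R) (m : σ →₀ ℕ) :
    coeff m ((aeval fun i => C (ε i) * X i) F : MvPolynomial σ R) =
      (∏ i, ε i ^ m i) * coeff m F := by
  classical
  induction F using MvPolynomial.induction_on' with
  | monomial d a =>
    have h : (aeval fun i => C (ε i) * X i) (monomial d a) =
        monomial d ((∏ i, ε i ^ d i) * a) := by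
      rw [aeval_monomial, Finsupp.prod_fintype _ _ (by simp), algebraMap_eq,
        monomial_eq (a := (∏ i, ε i ^ d i) * a), Finsupp.prod_fintype _ _ (by simp)]
      simp only [mul_pow, Finset.prod_mul_distrib, map_mul, map_prod, map_pow]
      ring
    rw [h, coeff_monomial, coeff_monomial]
    split_ifs with hd
    · rw [hd]
    · simp
  | add p q hp hq => simp only [map_add, coeff_add, hp, hq, mul_add]

/-- A form of degree `n` takes the value of its `X j ^ n`-coefficient at the `j`-th unit vector. -/
theorem MvPolynomial.IsHomogeneous.eval_single_one {σ R : Type*} [Fintype σ] [DecidableEq σ]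
    [CommSemiring R] {G : MvPolynomial σ R} {n : ℕ} (hG : G.IsHomogeneous n) (j : σ) :
    eval (Pi.single j 1) G = coeff (Finsupp.single j n) G := by
  rw [eval_eq', Finset.sum_eq_single (Finsupp.single j n)]
  · rw [Finset.prod_eq_one, mul_one]
    intro i _
    by_cases hij : i = j
    · subst hij; simp
    · simp [hij]
  · intro d hd hne
    have hdeg : d.degree = n := not_imp_comm.mp hG.coeff_eq_zero (mem_support_iff.mp hd)
    obtain ⟨i, hij, hi⟩ : ∃ i, i ≠ j ∧ d i ≠ 0 := by
      by_contra! h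
      have hdj : d = Finsupp.single j (d j) := by
        ext i
        by_cases hij : i = j
        · subst hij; simp
        · rw [h i hij, Finsupp.single_eq_of_ne hij]
      rw [hdj, Finsupp.degree_single] at hdeg
      exact hne (hdeg ▸ hdj)
    rw [Finset.prod_eq_zero (Finset.mem_univ i) (by simp [hij, hi]), mul_zero]
  · intro h
    rw [notMem_support_iff.mp h, zero_mul]

/-- Exponents of a polynomial semi-invariant under `n`-th roots of unity agree modulo `n`. -/
theorem MvPolynomial.modEq_of_semiinvariant {σ k : Type*} [Fintype σ] [Field k] {n : ℕ} [NeZero n] {ω : k}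
    (hω : IsPrimitiveRoot ω n) {F : MvPolynomial σ k}
    (hsemi : ∀ ε : σ → k, (∀ i, ε i ^ n = 1) →
      ∃ c : k, c ≠ 0 ∧ (aeval fun i => C (ε i) * X i) F = C c * F)
    {m m' : σ →₀ ℕ} (hm : coeff m F ≠ 0) (hm' : coeff m' F ≠ 0) (i : σ) :
    m i ≡ m' i [MOD n] := by
  classical
  obtain ⟨c, -, hc⟩ := hsemi (Function.update 1 i ω) fun l => by
    by_cases hl : l = i
    · subst hl; simpa using hω.pow_eq_one
    · simp [hl]
  have key (d : σ →₀ ℕ) (hd : coeff d F ≠ 0) : ω ^ d i = c := by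
    have h := congrArg (coeff d) hc
    rw [coeff_aeval_C_mul_X, coeff_C_mul] at h
    rw [← mul_right_cancel₀ hd h, Finset.prod_eq_single i] <;> simp +contextual
  have h := (key m hm).trans (key m' hm').symm
  rw [hω.eq_orderOf]
  exact (hω.isOfFinOrder (NeZero.ne n)).pow_eq_pow_iff_modEq.mp h

/-- At a unit vector where a form of degree `n + 1` is smooth, some monomial `X j ^ n * X i`
occurs in it. -/
theorem MvPolynomial.IsHomogeneous.exists_coeff_ne_zero_of_smooth {σ k : Type*} [Fintype σ]
    [Field k] {n : ℕ} {F : MvPolynomial σ k} (hF : F.IsHomogeneous (n + 1))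
    (hsmooth : ∀ v : σ → k, (∀ i, eval v (pderiv i F) = 0) → v = 0) (j : σ) :
    ∃ i, coeff (Finsupp.single j n + Finsupp.single i 1) F ≠ 0 := by
  classical
  by_contra! h
  have h0 := hsmooth (Pi.single j 1) fun i => by
    rw [(hF.pderiv (i := i)).eval_single_one]
    simp [coeff_pderiv, h]
  simpa using congrFun h0 j

/-- `k` algebraically closed with `char k ≠ 3`, `F` a nonzero cubic form in
four variables which is semi-invariant under the diagonal action of `(μ₃)⁴` and defines a
smooth surface (the partial derivatives vanish simultaneously only at the origin).
Then `F = a₀X₀³ + a₁X₁³ + a₂X₂³ + a₃X₃³` with all `aᵢ ≠ 0`. -/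
theorem semiinvariant_smooth_cubic_is_Fermat
    (k : Type*) [Field k] [IsAlgClosed k] (hchar : ringChar k ≠ 3)
    (F : MvPolynomial (Fin 4) k) (hF0 : F ≠ 0) (hF3 : F.IsHomogeneous 3)
    (hsemi : ∀ ε : Fin 4 → k, (∀ i, ε i ^ 3 = 1) →
      ∃ c : k, c ≠ 0 ∧
        (aeval fun i => C (ε i) * X i) F = C c * F)
    (hsmooth : ∀ v : Fin 4 → k, (∀ i, eval v (pderiv i F) = 0) → v = 0) :
    ∃ a : Fin 4 → k, (∀ i, a i ≠ 0) ∧ F = ∑ i, C (a i) * X i ^ 3 := by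
  have h3 : NeZero (3 : k) := ⟨fun h => hchar <|
    ((Nat.prime_three.eq_one_or_self_of_dvd _ (ringChar.dvd (by exact_mod_cast h))).resolve_left
      CharP.ringChar_ne_one)⟩
  have h3' : NeZero ((3 : ℕ) : k) := ⟨by exact_mod_cast h3.out⟩
  obtain ⟨ω, hω⟩ := HasEnoughRootsOfUnity.exists_primitiveRoot k 3
  have hmod {m m' : Fin 4 →₀ ℕ} (hm : coeff m F ≠ 0) (hm' : coeff m' F ≠ 0) (l : Fin 4) :
      m l ≡ m' l [MOD 3] := modEq_of_semiinvariant hω hsemi hm hm' l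
  choose f hf using hF3.exists_coeff_ne_zero_of_smooth (n := 2) hsmooth
  have hfix (j : Fin 4) : f j = j := by
    by_contra hj
    obtain ⟨l, hlj, hlf⟩ : ∃ l : Fin 4, l ≠ j ∧ l ≠ f j := by
      have hex : ∀ i j : Fin 4, ∃ l, l ≠ j ∧ l ≠ i := by decide
      exact hex (f j) j
    have hl := hmod (hf l) (hf j) l
    have hjl := hmod (hf l) (hf j) j
    by_cases hfl : f l = l
    · simp [hfl, Ne.symm hlj, Ne.symm hj, Nat.ModEq] at hjl
    · simp [Ne.symm hfl, hlj, hlf, Nat.ModEq] at hl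
  have hcube (j : Fin 4) : coeff (Finsupp.single j 3) F ≠ 0 := by
    have h := hf j
    rwa [hfix, ← Finsupp.single_add] at h
  refine ⟨fun j => coeff (Finsupp.single j 3) F, hcube, ?_⟩
  ext m
  simp only [coeff_sum, coeff_C_mul, coeff_X_pow]
  by_cases hm : ∃ j, m = Finsupp.single j 3
  · obtain ⟨j, rfl⟩ := hm
    simp [Finsupp.single_left_inj]
  · rw [Finset.sum_eq_zero fun j _ => by rw [if_neg fun h => hm ⟨j, h.symm⟩, mul_zero]]
    by_contra hne
    have hdeg : m.degree = 3 := not_imp_comm.mp hF3.coeff_eq_zero hne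
    have hdvd (l : Fin 4) : 3 ∣ m l := by
      have h := hmod hne (hcube l) l
      rw [Finsupp.single_eq_same] at h
      exact (Nat.modEq_zero_iff_dvd).mp (h.trans (by decide))
    obtain ⟨l, hl⟩ : ∃ l, m l ≠ 0 := by
      by_contra! h
      rw [show m = 0 from Finsupp.ext h] at hdeg
      simp at hdeg
    refine hm ⟨l, ?_⟩
    have hle : Finsupp.single l 3 ≤ m := by
      rw [Finsupp.single_le_iff]
      exact Nat.le_of_dvd (Nat.pos_of_ne_zero hl) (hdvd l)
    obtain ⟨d, rfl⟩ := exists_add_of_le hle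
    have hd : d.degree = 0 := by
      simpa using hdeg
    rw [(Finsupp.degree_eq_zero_iff d).mp hd, add_zero]
end
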